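/- Let w ∈ B(SO_{2l}) be a Weyl element supporting Bessel functions, with matrix representative w = t_n(w′)·w̃_n for the unique 0 ≤ n ≤ l−1 and w′ ∈ W(GL_n) such that w ∈ B_n(SO_{2l}), and let t = diag(t_1,…,t_{l−1}, [[a, bρ],[b, a]], t_{l−1}^{−1},…,t_1^{−1}) ∈ T. Then the image of t·w under the embedding of SO_{2l} into SO_{2l+1} lies in Q_l·w_l·V_l if and only if w ∈ B_{l−1}(SO_{2l}) and a ≠ 1. -/

import Mathlib

open scoped MatrixGroups
open Matrix

noncomputable section

namespace ConverseSO

open Classical in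
/-- Evaluate a function defined on `G` at a point of `M` through the (typically injective)
map `c : G → M`, extending by zero. -/
def matFun {G M R : Type*} [Zero R] (c : G → M) (φ : G → R) (m : M) : R :=
  if h : ∃ g, c g = m then φ h.choose else 0

variable (F : Type) [Field F] [Fintype F]

/-- The antidiagonal matrix `J_m`. -/
def Jmat (m : ℕ) : Matrix (Fin m) (Fin m) F :=
  Matrix.of fun i j => if (i : ℕ) + (j : ℕ) + 1 = m then 1 else 0

/-- The middle-block modification `diag(I_{l-1}, [[0,1],[-ρ,0]], I_{l-1})`. -/
def Dmat (l : ℕ) (ρ : F) : Matrix (Fin (2*l)) (Fin (2*l)) F :=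
  Matrix.of fun i j =>
    if (i : ℕ) = l - 1 ∧ (j : ℕ) = l then 1
    else if (i : ℕ) = l ∧ (j : ℕ) = l - 1 then -ρ
    else if i = j ∧ (i : ℕ) ≠ l - 1 ∧ (i : ℕ) ≠ l then 1
    else 0

/-- `J_{2l,ρ}`. -/
def Jrho (l : ℕ) (ρ : F) : Matrix (Fin (2*l)) (Fin (2*l)) F := Dmat F l ρ * Jmat F (2*l)

/-- The matrix-level special orthogonal "set" attached to a matrix `Jm`. -/
def SOset (m : ℕ) (Jm : Matrix (Fin m) (Fin m) F) : Set (Matrix (Fin m) (Fin m) F) :=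
  {g | g.det = 1 ∧ gᵀ * Jm * g = Jm}

/-- The special orthogonal group attached to a matrix `Jm`, as a subgroup of `GL`. -/
def SOgrp (m : ℕ) (Jm : Matrix (Fin m) (Fin m) F) : Subgroup (GL (Fin m) F) where
  carrier := {g | ((g : Matrix (Fin m) (Fin m) F)).det = 1 ∧
    ((g : Matrix (Fin m) (Fin m) F))ᵀ * Jm * ((g : Matrix (Fin m) (Fin m) F)) = Jm}
  one_mem' := ⟨by simp, by simp⟩
  mul_mem' := by
    rintro a b ⟨ha1, ha2⟩ ⟨hb1, hb2⟩
    refine ⟨by rw [Units.val_mul, Matrix.det_mul, ha1, hb1, one_mul], ?_⟩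
    have hab : ((a * b : GL (Fin m) F) : Matrix (Fin m) (Fin m) F)
        = (a : Matrix (Fin m) (Fin m) F) * (b : Matrix (Fin m) (Fin m) F) := Units.val_mul a b
    rw [hab, Matrix.transpose_mul]
    calc (b : Matrix (Fin m) (Fin m) F)ᵀ * (a : Matrix (Fin m) (Fin m) F)ᵀ * Jm *
          ((a : Matrix (Fin m) (Fin m) F) * (b : Matrix (Fin m) (Fin m) F))
        = (b : Matrix (Fin m) (Fin m) F)ᵀ *
            ((a : Matrix (Fin m) (Fin m) F)ᵀ * Jm * (a : Matrix (Fin m) (Fin m) F)) *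
            (b : Matrix (Fin m) (Fin m) F) := by
          simp only [mul_assoc]
      _ = Jm := by rw [ha2, hb2]
  inv_mem' := by
    intro g hg
    obtain ⟨h1, h2⟩ := hg
    have hv1 : ((g⁻¹ : GL (Fin m) F) : Matrix (Fin m) (Fin m) F) * (g : Matrix (Fin m) (Fin m) F)
        = 1 := by rw [← Units.val_mul, inv_mul_cancel, Units.val_one]
    have hv2 : (g : Matrix (Fin m) (Fin m) F) * ((g⁻¹ : GL (Fin m) F) : Matrix (Fin m) (Fin m) F)
        = 1 := by rw [← Units.val_mul, mul_inv_cancel, Units.val_one]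
    constructor
    · have hd := congrArg Matrix.det hv1
      rw [Matrix.det_mul, h1, mul_one, Matrix.det_one] at hd
      exact hd
    · calc ((g⁻¹ : GL (Fin m) F) : Matrix (Fin m) (Fin m) F)ᵀ * Jm *
            ((g⁻¹ : GL (Fin m) F) : Matrix (Fin m) (Fin m) F)
          = ((g⁻¹ : GL (Fin m) F) : Matrix (Fin m) (Fin m) F)ᵀ *
              ((g : Matrix (Fin m) (Fin m) F)ᵀ * Jm * (g : Matrix (Fin m) (Fin m) F)) *
              ((g⁻¹ : GL (Fin m) F) : Matrix (Fin m) (Fin m) F) := by rw [h2]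
        _ = ((g : Matrix (Fin m) (Fin m) F) *
              ((g⁻¹ : GL (Fin m) F) : Matrix (Fin m) (Fin m) F))ᵀ * Jm *
              ((g : Matrix (Fin m) (Fin m) F) *
              ((g⁻¹ : GL (Fin m) F) : Matrix (Fin m) (Fin m) F)) := by
            rw [Matrix.transpose_mul]; simp only [mul_assoc]
        _ = Jm := by rw [hv2]; simp

/-- The quasi-split even special orthogonal group `SO_{2l}` attached to `J_{2l,ρ}`. -/
abbrev SO2l (l : ℕ) (ρ : F) : Subgroup (GL (Fin (2*l)) F) := SOgrp F (2*l) (Jrho F l ρ)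

/-- The odd special orthogonal group `SO_{2m+1}` (split form). -/
abbrev SOodd (m : ℕ) : Subgroup (GL (Fin (2*m+1)) F) := SOgrp F (2*m+1) (Jmat F (2*m+1))

/-- The underlying matrix of an element of a special orthogonal group. -/
def mat {m : ℕ} {Jm : Matrix (Fin m) (Fin m) F} (g : SOgrp F m Jm) :
    Matrix (Fin m) (Fin m) F :=
  ((g : GL (Fin m) F) : Matrix (Fin m) (Fin m) F)

/-- Upper triangular unipotent predicate for matrices. -/
def upUnip {m : ℕ} (M : Matrix (Fin m) (Fin m) F) : Prop :=
  ∀ i j : Fin m, (j : ℕ) ≤ (i : ℕ) → M i j = if i = j then 1 else 0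

/-- The upper triangular unipotent subgroup (as a set) of `SO_{2l}`. -/
def USet (l : ℕ) (ρ : F) : Set (SO2l F l ρ) := {u | upUnip F (mat F u)}

/-- The upper triangular unipotent matrices in `SO_{2m+1}` (matrix level). -/
def UoddMatSet (m : ℕ) : Set (Matrix (Fin (2*m+1)) (Fin (2*m+1)) F) :=
  {g | g ∈ SOset F (2*m+1) (Jmat F (2*m+1)) ∧ upUnip F g}

/-- The generic character of the upper unipotent subgroup of `SO_{2l}`:
`ψ(u_{1,2} + ⋯ + u_{l-2,l-1} + (1/2)·u_{l-1,l+1})` (1-indexed). -/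
def psiU (l : ℕ) (ψ : AddChar F ℂ) (M : Matrix (Fin (2*l)) (Fin (2*l)) F) : ℂ :=
  ψ (∑ i : Fin (2*l), ∑ j : Fin (2*l),
    (if (j : ℕ) = (i : ℕ) + 1 ∧ (i : ℕ) + 3 ≤ l then M i j
     else if (i : ℕ) + 2 = l ∧ (j : ℕ) = l then (2 : F)⁻¹ * M i j else 0))

/-- The sum `u_{1,2} + ⋯ + u_{n-1,n}` for an `n × n` matrix. -/
def glUSum (n : ℕ) (M : Matrix (Fin n) (Fin n) F) : F :=
  ∑ i : Fin n, ∑ j : Fin n, (if (j : ℕ) = (i : ℕ) + 1 then M i j else 0)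

/-- The character `ψ_γ` of `N^{l-n}`:
`ψ(Σ_{i=1}^{l-n-1} v_{i,i+1} + (1/2)·v_{l-n-1,l+1})` (1-indexed). -/
def psiGam (l n : ℕ) (ψ : AddChar F ℂ) (M : Matrix (Fin (2*l)) (Fin (2*l)) F) : ℂ :=
  ψ (∑ i : Fin (2*l), ∑ j : Fin (2*l),
    (if (j : ℕ) = (i : ℕ) + 1 ∧ (i : ℕ) + 2 + n ≤ l then M i j
     else if (i : ℕ) + 2 + n = l ∧ (j : ℕ) = l then (2 : F)⁻¹ * M i j else 0))

/-- Irreducibility of a representation. -/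
def IsIrrep {G V : Type*} [Group G] [AddCommGroup V] [Module ℂ V]
    (π : Representation ℂ G V) : Prop :=
  (∃ v : V, v ≠ 0) ∧
    ∀ W : Submodule ℂ V, (∀ g : G, ∀ v ∈ W, π g v ∈ W) → W = ⊥ ∨ W = ⊤

/-- Block index function determined by a set `C` of cuts (and their mirrors) for `SO_{2l}`. -/
def blkCut (l : ℕ) (C : Finset ℕ) (i : ℕ) : ℕ :=
  (C.filter (fun c => c ≤ i)).card + (C.filter (fun c => 2*l - c ≤ i)).card

/-- The unipotent radical of the standard parabolic subgroup of `SO_{2l}` given by cuts `C`. -/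
def cuspUnip (l : ℕ) (ρ : F) (C : Finset ℕ) : Set (SO2l F l ρ) :=
  {g | ∀ i j : Fin (2*l), blkCut l C (j : ℕ) ≤ blkCut l C (i : ℕ) →
    mat F g i j = if i = j then 1 else 0}

/-- Cuspidality: the full unipotent-radical sums vanish for every proper standard parabolic. -/
def IsCuspidal (l : ℕ) (ρ : F) {V : Type*} [AddCommGroup V] [Module ℂ V]
    (π : Representation ℂ (SO2l F l ρ) V) : Prop :=
  ∀ C : Finset ℕ, C.Nonempty → (∀ c ∈ C, 1 ≤ c ∧ c ≤ l - 1) →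
    ∀ v : V, (∑ᶠ u ∈ cuspUnip F l ρ C, π u v) = 0

/-- `Γ` is a (nonzero) `ψ`-Whittaker functional for `π`. -/
def IsWhittaker (l : ℕ) (ρ : F) (ψ : AddChar F ℂ) {V : Type*} [AddCommGroup V] [Module ℂ V]
    (π : Representation ℂ (SO2l F l ρ) V) (Γ : V →ₗ[ℂ] ℂ) : Prop :=
  Γ ≠ 0 ∧ ∀ u ∈ USet F l ρ, ∀ v : V, Γ (π u v) = psiU F l ψ (mat F u) * Γ v

/-- `v₀` is a Whittaker vector with `Γ v₀ ≠ 0`. -/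
def IsWhitVec (l : ℕ) (ρ : F) (ψ : AddChar F ℂ) {V : Type*} [AddCommGroup V] [Module ℂ V]
    (π : Representation ℂ (SO2l F l ρ) V) (Γ : V →ₗ[ℂ] ℂ) (v₀ : V) : Prop :=
  Γ v₀ ≠ 0 ∧ ∀ u ∈ USet F l ρ, π u v₀ = psiU F l ψ (mat F u) • v₀

/-- The normalized Bessel function attached to the Whittaker data `(Γ, v₀)`. -/
def Bessel (l : ℕ) (ρ : F) {V : Type*} [AddCommGroup V] [Module ℂ V]
    (π : Representation ℂ (SO2l F l ρ) V) (Γ : V →ₗ[ℂ] ℂ) (v₀ : V) :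
    SO2l F l ρ → ℂ :=
  fun g => Γ (π g v₀) / Γ v₀

/-- Equality of central characters. -/
def SameCentralChar (l : ℕ) (ρ : F) {V V' : Type*} [AddCommGroup V] [Module ℂ V]
    [AddCommGroup V'] [Module ℂ V'] (π : Representation ℂ (SO2l F l ρ) V)
    (π' : Representation ℂ (SO2l F l ρ) V') : Prop :=
  ∃ ω : ℂ, (∀ g : SO2l F l ρ, mat F g = -1 → ∀ v : V, π g v = ω • v) ∧
    (∀ g : SO2l F l ρ, mat F g = -1 → ∀ v' : V', π' g v' = ω • v')
/-- `a^* = J_n · (a⁻¹)ᵀ · J_n`. -/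
def aStar (n : ℕ) (a : Matrix (Fin n) (Fin n) F) : Matrix (Fin n) (Fin n) F :=
  Jmat F n * (a⁻¹)ᵀ * Jmat F n

/-- The permutation matrix of `σ`. -/
def permMat (n : ℕ) (σ : Equiv.Perm (Fin n)) : Matrix (Fin n) (Fin n) F :=
  Matrix.of fun i j => if σ j = i then 1 else 0

/-- `t_n(a) = diag(a, I_{2l-2n}, a^*)` inside `2l × 2l` matrices. -/
def tnMat (l n : ℕ) (a : Matrix (Fin n) (Fin n) F) : Matrix (Fin (2*l)) (Fin (2*l)) F :=
  Matrix.of fun i j =>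
    if hi : (i : ℕ) < n then (if hj : (j : ℕ) < n then a ⟨i, hi⟩ ⟨j, hj⟩ else 0)
    else if hi2 : (i : ℕ) < 2*l - n then (if i = j then 1 else 0)
    else if hj2 : 2*l - n ≤ (j : ℕ) then
      aStar F n a ⟨(i : ℕ) - (2*l - n), by have := i.isLt; omega⟩
        ⟨(j : ℕ) - (2*l - n), by have := j.isLt; omega⟩
    else 0

/-- The Weyl representative `w̃_n` of `SO_{2l}` as a block matrix. -/
def wTildeMat (l n : ℕ) : Matrix (Fin (2*l)) (Fin (2*l)) F :=
  Matrix.of fun i j =>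
    if (i : ℕ) < n then (if (j : ℕ) = (i : ℕ) + (2*l - n) then 1 else 0)
    else if (i : ℕ) < l - 1 then (if i = j then 1 else 0)
    else if (i : ℕ) = l - 1 then (if i = j then (-1)^n else 0)
    else if (i : ℕ) < 2*l - n then (if i = j then 1 else 0)
    else (if (j : ℕ) + (2*l - n) = (i : ℕ) then 1 else 0)

/-- The torus matrix `diag(t_1,…,t_{l-1}, [[a,bρ],[b,a]], t_{l-1}⁻¹,…,t_1⁻¹)`. -/
def torusMat (l : ℕ) (ρ : F) (tv : ℕ → Fˣ) (a b : F) :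
    Matrix (Fin (2*l)) (Fin (2*l)) F :=
  Matrix.of fun i j =>
    if (i : ℕ) < l - 1 then (if i = j then (tv (i : ℕ) : F) else 0)
    else if (i : ℕ) = l - 1 then
      (if (j : ℕ) = l - 1 then a else if (j : ℕ) = l then b * ρ else 0)
    else if (i : ℕ) = l then
      (if (j : ℕ) = l - 1 then b else if (j : ℕ) = l then a else 0)
    else (if i = j then ((tv (2*l - 1 - (i : ℕ)))⁻¹ : F) else 0)

/-- The outer element `c = diag(I_{l-1}, 1, -1, I_{l-1})`. -/
def cMat (l : ℕ) : Matrix (Fin (2*l)) (Fin (2*l)) F :=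
  Matrix.of fun i j => if i = j then (if (i : ℕ) = l then -1 else 1) else 0

/-- The torus element `t̃ = diag(I_{l-1}, -1, -1, I_{l-1})`. -/
def tTildeMat (l : ℕ) : Matrix (Fin (2*l)) (Fin (2*l)) F :=
  Matrix.of fun i j =>
    if i = j then (if (i : ℕ) = l - 1 ∨ (i : ℕ) = l then -1 else 1) else 0

/-- `l_n(a) = diag(a, 1, a^*)` inside `(2n+1) × (2n+1)` matrices. -/
def lnMat (n : ℕ) (a : Matrix (Fin n) (Fin n) F) :
    Matrix (Fin (2*n+1)) (Fin (2*n+1)) F :=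
  Matrix.of fun i j =>
    if hi : (i : ℕ) < n then (if hj : (j : ℕ) < n then a ⟨i, hi⟩ ⟨j, hj⟩ else 0)
    else if hi2 : (i : ℕ) = n then (if i = j then 1 else 0)
    else if hj2 : n + 1 ≤ (j : ℕ) then
      aStar F n a ⟨(i : ℕ) - (n+1), by have := i.isLt; omega⟩
        ⟨(j : ℕ) - (n+1), by have := j.isLt; omega⟩
    else 0

/-- The Weyl element `w_n` of `SO_{2n+1}` with block rows `(0,0,I_n)`, `(0,(-1)^n,0)`, `(I_n,0,0)`. -/
def wnOddMat (n : ℕ) : Matrix (Fin (2*n+1)) (Fin (2*n+1)) F :=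
  Matrix.of fun i j =>
    if (i : ℕ) < n then (if (j : ℕ) = (i : ℕ) + n + 1 then 1 else 0)
    else if (i : ℕ) = n then (if i = j then (-1)^n else 0)
    else (if (j : ℕ) + n + 1 = (i : ℕ) then 1 else 0)

/-- `d_n = diag(-1, 1, …, (-1)^n)`. -/
def dnMat (n : ℕ) : Matrix (Fin n) (Fin n) F :=
  Matrix.of fun i j => if i = j then (-1)^((i : ℕ) + 1) else 0

/-- The block permutation matrix `w^{l,n}` of `SO_{2l}`. -/
def wlnMat (l n : ℕ) : Matrix (Fin (2*l)) (Fin (2*l)) F :=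
  Matrix.of fun i j =>
    if (i : ℕ) < n then (if (j : ℕ) = (i : ℕ) + (l - n - 1) then 1 else 0)
    else if (i : ℕ) < l - 1 then (if (j : ℕ) + n = (i : ℕ) then 1 else 0)
    else if (i : ℕ) < l + 1 then (if i = j then 1 else 0)
    else if (i : ℕ) < 2*l - n then (if (j : ℕ) = (i : ℕ) + n then 1 else 0)
    else (if (j : ℕ) + (l - n - 1) = (i : ℕ) then 1 else 0)

/-- `w_{l,l} = diag(γ·I_l, 1, γ⁻¹·I_l)` with `γ = ρ/2`. -/
def wllMat (l : ℕ) (ρ : F) : Matrix (Fin (2*l+1)) (Fin (2*l+1)) F :=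
  Matrix.of fun i j =>
    if i = j then
      (if (i : ℕ) < l then ρ/2 else if (i : ℕ) = l then 1 else (ρ/2)⁻¹)
    else 0

/-- The conjugating matrix `M` for the embedding of `SO_{2l}` into `SO_{2l+1}`. -/
def Mtop (l : ℕ) (ρ : F) : Matrix (Fin (2*l+1)) (Fin (2*l+1)) F :=
  Matrix.of fun i j =>
    if (i : ℕ) + 2 = l + 1 then (if (j : ℕ) = l then 1 else 0)
    else if (i : ℕ) = l then
      (if (j : ℕ) + 2 = l + 1 then (2 : F)⁻¹
       else if (j : ℕ) = l + 1 then (2 * (ρ/2))⁻¹ else 0)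
    else if (i : ℕ) = l + 1 then
      (if (j : ℕ) + 2 = l + 1 then (2 : F)⁻¹
       else if (j : ℕ) = l + 1 then -(2 * (ρ/2))⁻¹ else 0)
    else if i = j then 1 else 0

/-- Insert a trivial `(l+1)`-st row and column (1-indexed) into a `2l × 2l` matrix. -/
def insTop (l : ℕ) (g : Matrix (Fin (2*l)) (Fin (2*l)) F) :
    Matrix (Fin (2*l+1)) (Fin (2*l+1)) F :=
  Matrix.of fun i j =>
    if hi : (i : ℕ) = l then (if (j : ℕ) = l then 1 else 0)
    else if hj : (j : ℕ) = l then 0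
    else
      g ⟨if (i : ℕ) < l then (i : ℕ) else (i : ℕ) - 1, by have := i.isLt; split <;> omega⟩
        ⟨if (j : ℕ) < l then (j : ℕ) else (j : ℕ) - 1, by have := j.isLt; split <;> omega⟩

/-- The embedding of `SO_{2l}` into `SO_{2l+1}` at the matrix level. -/
def embTop (l : ℕ) (ρ : F) (g : Matrix (Fin (2*l)) (Fin (2*l)) F) :
    Matrix (Fin (2*l+1)) (Fin (2*l+1)) F :=
  (Mtop F l ρ)⁻¹ * insTop F l g * Mtop F l ρ

/-- The conjugating matrix `M = diag(I_n, [[0,2],[1,0]], I_n)` (size `2n+2`). -/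
def Mlow (n : ℕ) : Matrix (Fin (2*n+2)) (Fin (2*n+2)) F :=
  Matrix.of fun i j =>
    if (i : ℕ) = n then (if (j : ℕ) = n + 1 then 2 else 0)
    else if (i : ℕ) = n + 1 then (if (j : ℕ) = n then 1 else 0)
    else if i = j then 1 else 0

/-- Insert a trivial `(n+2)`-nd row and column (1-indexed) into a `(2n+1) × (2n+1)` matrix. -/
def insLow (n : ℕ) (g : Matrix (Fin (2*n+1)) (Fin (2*n+1)) F) :
    Matrix (Fin (2*n+2)) (Fin (2*n+2)) F :=
  Matrix.of fun i j =>
    if hi : (i : ℕ) = n + 1 then (if (j : ℕ) = n + 1 then 1 else 0)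
    else if hj : (j : ℕ) = n + 1 then 0
    else
      g ⟨if (i : ℕ) < n + 1 then (i : ℕ) else (i : ℕ) - 1, by have := i.isLt; split <;> omega⟩
        ⟨if (j : ℕ) < n + 1 then (j : ℕ) else (j : ℕ) - 1, by have := j.isLt; split <;> omega⟩

/-- The middle `2n+2` block of the embedding of `SO_{2n+1}` into `SO_{2l}`. -/
def embLowMid (n : ℕ) (g : Matrix (Fin (2*n+1)) (Fin (2*n+1)) F) :
    Matrix (Fin (2*n+2)) (Fin (2*n+2)) F :=
  (Mlow F n)⁻¹ * insLow F n g * Mlow F n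

/-- The embedding of `SO_{2n+1}` into `SO_{2l}` (for `n < l`) at the matrix level. -/
def embLow (l n : ℕ) (g : Matrix (Fin (2*n+1)) (Fin (2*n+1)) F) :
    Matrix (Fin (2*l)) (Fin (2*l)) F :=
  Matrix.of fun i j =>
    if h : l - n - 1 ≤ (i : ℕ) ∧ (i : ℕ) < l + n + 1 ∧ l - n - 1 ≤ (j : ℕ) ∧ (j : ℕ) < l + n + 1
    then embLowMid F n g ⟨(i : ℕ) - (l - n - 1), by omega⟩ ⟨(j : ℕ) - (l - n - 1), by omega⟩
    else if i = j then 1 else 0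
/-- The maximal torus `T` of `SO_{2l}`. -/
def TSet (l : ℕ) (ρ : F) : Set (SO2l F l ρ) :=
  {g | ∃ (tv : ℕ → Fˣ) (a b : F), a^2 - b^2 * ρ = 1 ∧ mat F g = torusMat F l ρ tv a b}

/-- The split subtorus `S` of `T`. -/
def SSet (l : ℕ) (ρ : F) : Set (SO2l F l ρ) :=
  {g | ∃ tv : ℕ → Fˣ, mat F g = torusMat F l ρ tv 1 0}

/-- The standard Borel subgroup `B = T·U` of `SO_{2l}` (as a set). -/
def BorelSet (l : ℕ) (ρ : F) : Set (SO2l F l ρ) :=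
  {b | ∃ t ∈ TSet F l ρ, ∃ u ∈ USet F l ρ, b = t * u}

/-- `w` normalizes the torus `T`. -/
def NormalizesT (l : ℕ) (ρ : F) (w : SO2l F l ρ) : Prop :=
  ∀ t ∈ TSet F l ρ, w * t * w⁻¹ ∈ TSet F l ρ ∧ w⁻¹ * t * w ∈ TSet F l ρ

/-- Standard basis weight `e_k` (as an integral character vector). -/
def eVec (k : ℕ) : ℕ → ℤ := fun i => if i = k then 1 else 0

/-- The simple (restricted) roots of `SO_{2l}`: `α_k = e_k - e_{k+1}` for `k < l-2`
(0-indexed) and `α_{l-2} = e_{l-2}`. -/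
def simpleRoot (l k : ℕ) : ℕ → ℤ :=
  fun i => (if i = k then 1 else 0) - (if i = k + 1 ∧ k + 3 ≤ l then 1 else 0)

/-- The positive (restricted) roots of `SO_{2l}` (type `B_{l-1}`). -/
def posRoot (l : ℕ) : Set (ℕ → ℤ) :=
  {α | (∃ i j, i < j ∧ j < l - 1 ∧ α = fun k => eVec i k - eVec j k) ∨
       (∃ i j, i < j ∧ j < l - 1 ∧ α = fun k => eVec i k + eVec j k) ∨
       (∃ i, i < l - 1 ∧ α = eVec i)}

/-- Negative roots. -/
def negRoot (l : ℕ) : Set (ℕ → ℤ) := {α | (fun k => -(α k)) ∈ posRoot l}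

/-- Simple roots (as a set). -/
def isSimpleRoot (l : ℕ) (α : ℕ → ℤ) : Prop := ∃ k, k < l - 1 ∧ α = simpleRoot l k

/-- Evaluation of an integral character vector on an element of the split torus. -/
def rootEval (l : ℕ) (ρ : F) (α : ℕ → ℤ) (g : SO2l F l ρ) : F :=
  ∏ i : Fin (2*l), (if (i : ℕ) < l - 1 then (mat F g i i) ^ (α (i : ℕ)) else 1)

/-- The Weyl representative `w` maps the character `α` of `S` to the character `β`. -/
def mapsRoot (l : ℕ) (ρ : F) (w : SO2l F l ρ) (α β : ℕ → ℤ) : Prop :=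
  ∀ s ∈ SSet F l ρ, w⁻¹ * s * w ∈ SSet F l ρ ∧
    rootEval F l ρ β s = rootEval F l ρ α (w⁻¹ * s * w)

/-- The Weyl representative `w` supports Bessel functions: every simple root is mapped
to a negative or simple root. -/
def SupportsBessel (l : ℕ) (ρ : F) (w : SO2l F l ρ) : Prop :=
  ∀ k, k < l - 1 → ∃ β : ℕ → ℤ, mapsRoot F l ρ w (simpleRoot l k) β ∧
    (β ∈ negRoot l ∨ isSimpleRoot l β)

/-- `θ_w = {k : wα_k is positive}`. -/
def besselTheta (l : ℕ) (ρ : F) (w : SO2l F l ρ) : Set ℕ :=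
  {k | k < l - 1 ∧ ∃ β : ℕ → ℤ, mapsRoot F l ρ w (simpleRoot l k) β ∧ β ∈ posRoot l}

/-- The cell `B_n(SO_{2l}) = {t_n(w')·w̃_n : w' ∈ W(GL_n)}`. -/
def BnSet (l : ℕ) (ρ : F) (n : ℕ) : Set (SO2l F l ρ) :=
  {g | ∃ σ : Equiv.Perm (Fin n), mat F g = tnMat F l n (permMat F n σ) * wTildeMat F l n}

/-- Block index for the Siegel parabolic of `SO_{2n+1}`. -/
def blkSiegel (n i : ℕ) : ℕ := if i < n then 0 else if i = n then 1 else 2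

/-- The unipotent radical `V_n` of the Siegel parabolic of `SO_{2n+1}` (matrix level). -/
def VnSet (n : ℕ) : Set (Matrix (Fin (2*n+1)) (Fin (2*n+1)) F) :=
  {m | m ∈ SOset F (2*n+1) (Jmat F (2*n+1)) ∧
    ∀ i j : Fin (2*n+1), blkSiegel n (j : ℕ) ≤ blkSiegel n (i : ℕ) →
      m i j = if i = j then 1 else 0}

/-- The group `R^{l,n}` (matrix level). -/
def RlnSet (l : ℕ) (ρ : F) (n : ℕ) : Set (Matrix (Fin (2*l)) (Fin (2*l)) F) :=
  {m | m ∈ SOset F (2*l) (Jrho F l ρ) ∧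
    ∀ i j : Fin (2*l),
      ¬((n ≤ (i : ℕ) ∧ (i : ℕ) < l - 1 ∧ (j : ℕ) < n) ∨
        (2*l - n ≤ (i : ℕ) ∧ l + 1 ≤ (j : ℕ) ∧ (j : ℕ) < 2*l - n)) →
      m i j = if i = j then 1 else 0}

/-- The subgroup `N^{l-n} = U_{GL_{l-n-1}}·N_{l-n-1}` of `SO_{2l}`. -/
def NlnSet (l : ℕ) (ρ : F) (n : ℕ) : Set (SO2l F l ρ) :=
  {g | upUnip F (mat F g) ∧
    ∀ i j : Fin (2*l), l - n - 1 ≤ (i : ℕ) → (i : ℕ) < l + n + 1 →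
      l - n - 1 ≤ (j : ℕ) → (j : ℕ) < l + n + 1 →
      mat F g i j = if i = j then 1 else 0}

/-- Block index for standard parabolic subgroups of `SO_{2m+1}`, given cuts `C`. -/
def blkB (m : ℕ) (C : Finset ℕ) (i : ℕ) : ℕ :=
  (C.filter (fun c => c ≤ i)).card + (C.filter (fun c => 2*m + 1 - c ≤ i)).card

/-- The standard parabolic subgroup of `SO_{2m+1}` given by cuts `C` (as a set). -/
def pbP (m : ℕ) (C : Finset ℕ) : Set (SOodd F m) :=
  {g | ∀ i j : Fin (2*m+1), blkB m C (j : ℕ) < blkB m C (i : ℕ) → mat F g i j = 0}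

/-- The unipotent radical of the standard parabolic subgroup of `SO_{2m+1}` given by cuts `C`. -/
def pbV (m : ℕ) (C : Finset ℕ) : Set (SOodd F m) :=
  {g | ∀ i j : Fin (2*m+1), blkB m C (j : ℕ) ≤ blkB m C (i : ℕ) →
    mat F g i j = if i = j then 1 else 0}
/-- Apply a representation of `GL_n(F)` at a plain matrix (zero if not invertible). -/
def tauApp (n : ℕ) {Wτ : Type*} [AddCommGroup Wτ] [Module ℂ Wτ]
    (τ : Representation ℂ (GL (Fin n) F) Wτ) (m : Matrix (Fin n) (Fin n) F) :
    Wτ →ₗ[ℂ] Wτ :=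
  matFun (fun g : GL (Fin n) F => (g : Matrix (Fin n) (Fin n) F)) (fun g => τ g) m

/-- `Λ` is a nonzero `ψ⁻¹`-Whittaker functional for the representation `τ` of `GL_n(F)`. -/
def IsGenericGLinv (n : ℕ) (ψ : AddChar F ℂ) {Wτ : Type*} [AddCommGroup Wτ] [Module ℂ Wτ]
    (τ : Representation ℂ (GL (Fin n) F) Wτ) (Λ : Wτ →ₗ[ℂ] ℂ) : Prop :=
  Λ ≠ 0 ∧ ∀ u : GL (Fin n) F, upUnip F ((u : Matrix (Fin n) (Fin n) F)) →
    ∀ x : Wτ, Λ (τ u x) = ψ (-(glUSum F n (u : Matrix (Fin n) (Fin n) F))) * Λ x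

/-- The induced space `I(τ) = Ind_{Q_n}^{SO_{2n+1}} τ` (matrix level). -/
def IndTau (n : ℕ) {Wτ : Type*} [AddCommGroup Wτ] [Module ℂ Wτ]
    (τ : Representation ℂ (GL (Fin n) F) Wτ) :
    Set (Matrix (Fin (2*n+1)) (Fin (2*n+1)) F → Wτ) :=
  {ξ | (∀ g, g ∉ SOset F (2*n+1) (Jmat F (2*n+1)) → ξ g = 0) ∧
    ∀ a : GL (Fin n) F, ∀ u ∈ VnSet F n, ∀ g,
      ξ (lnMat F n (a : Matrix (Fin n) (Fin n) F) * u * g) = τ a (ξ g)}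

/-- The space `I(τ, ψ⁻¹)` spanned by the functions `f_ξ(g,a) = Λ(τ(a)ξ(g))`. -/
def Imodel (n : ℕ) {Wτ : Type*} [AddCommGroup Wτ] [Module ℂ Wτ]
    (τ : Representation ℂ (GL (Fin n) F) Wτ) (Λ : Wτ →ₗ[ℂ] ℂ) :
    Set (Matrix (Fin (2*n+1)) (Fin (2*n+1)) F → Matrix (Fin n) (Fin n) F → ℂ) :=
  {f | ∃ ξ ∈ IndTau F n τ, f = fun g a => Λ (tauApp F n τ a (ξ g))}

open Classical in
/-- The section `ξ_v ∈ I(τ)` supported on the Siegel parabolic with `ξ_v(l_n(a)u) = τ(a)v`. -/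
def xiv (n : ℕ) {Wτ : Type*} [AddCommGroup Wτ] [Module ℂ Wτ]
    (τ : Representation ℂ (GL (Fin n) F) Wτ) (v : Wτ) :
    Matrix (Fin (2*n+1)) (Fin (2*n+1)) F → Wτ :=
  fun m =>
    if h : ∃ p : (GL (Fin n) F) × Matrix (Fin (2*n+1)) (Fin (2*n+1)) F,
        p.2 ∈ VnSet F n ∧ m = lnMat F n ((p.1 : Matrix (Fin n) (Fin n) F)) * p.2
    then τ h.choose.1 v else 0

/-- The function `f_v = f_{ξ_v} ∈ I(τ, ψ⁻¹)`. -/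
def fvFun (n : ℕ) {Wτ : Type*} [AddCommGroup Wτ] [Module ℂ Wτ]
    (τ : Representation ℂ (GL (Fin n) F) Wτ) (Λ : Wτ →ₗ[ℂ] ℂ) (v : Wτ) :
    Matrix (Fin (2*n+1)) (Fin (2*n+1)) F → Matrix (Fin n) (Fin n) F → ℂ :=
  fun g a => Λ (tauApp F n τ a (xiv F n τ v g))

/-- The intertwining operator `M(τ, ψ⁻¹)` at the level of functions. -/
def MOp (n : ℕ)
    (f : Matrix (Fin (2*n+1)) (Fin (2*n+1)) F → Matrix (Fin n) (Fin n) F → ℂ) :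
    Matrix (Fin (2*n+1)) (Fin (2*n+1)) F → Matrix (Fin n) (Fin n) F → ℂ :=
  fun h a => ∑ᶠ u ∈ VnSet F n, f (wnOddMat F n * u * h) (dnMat F n * aStar F n a)

/-- The zeta integral for `n < l`, via the embedding `SO_{2n+1} → SO_{2l}`
(the sum over coset representatives is realized as `|U|⁻¹` times the full sum). -/
def ZetaLow (l : ℕ) (ρ : F) (n : ℕ) (φ : SO2l F l ρ → ℂ)
    (f : Matrix (Fin (2*n+1)) (Fin (2*n+1)) F → Matrix (Fin n) (Fin n) F → ℂ) : ℂ :=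
  (Nat.card (UoddMatSet F n) : ℂ)⁻¹ *
    ∑ᶠ g ∈ SOset F (2*n+1) (Jmat F (2*n+1)),
      (∑ᶠ r ∈ RlnSet F l ρ n,
        matFun (fun x : SO2l F l ρ => mat F x) φ
          (r * wlnMat F l n * embLow F l n g * (wlnMat F l n)⁻¹)) * f g 1

/-- The zeta integral for `n = l`, via the embedding `SO_{2l} → SO_{2l+1}`. -/
def ZetaTop (l : ℕ) (ρ : F) (φ : SO2l F l ρ → ℂ)
    (f : Matrix (Fin (2*l+1)) (Fin (2*l+1)) F → Matrix (Fin l) (Fin l) F → ℂ) : ℂ :=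
  (Nat.card (USet F l ρ) : ℂ)⁻¹ *
    ∑ᶠ g : SO2l F l ρ, φ g * f (wllMat F l ρ * embTop F l ρ (mat F g)) 1

/-- The combined zeta integral `Ψ` for `1 ≤ n ≤ l`. -/
def Zeta (l : ℕ) (ρ : F) (n : ℕ) (φ : SO2l F l ρ → ℂ)
    (f : Matrix (Fin (2*n+1)) (Fin (2*n+1)) F → Matrix (Fin n) (Fin n) F → ℂ) : ℂ :=
  if n < l then ZetaLow F l ρ n φ f
  else if h : n = l then ZetaTop F l ρ φ (cast (by rw [h]) f)
  else 0

/-- `c` is the gamma factor `γ(π × τ, ψ)`: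
`c · Ψ(W_v, f) = Ψ(W_v, M(τ,ψ⁻¹) f)` for all Whittaker functions `W_v` of `π`
and all `f ∈ I(τ, ψ⁻¹)`. -/
def IsGamma (l : ℕ) (ρ : F) (n : ℕ) {V : Type*} [AddCommGroup V] [Module ℂ V]
    (π : Representation ℂ (SO2l F l ρ) V) (Γ : V →ₗ[ℂ] ℂ)
    {Wτ : Type*} [AddCommGroup Wτ] [Module ℂ Wτ]
    (τ : Representation ℂ (GL (Fin n) F) Wτ) (Λ : Wτ →ₗ[ℂ] ℂ) (c : ℂ) : Prop :=
  ∀ v : V, ∀ f ∈ Imodel F n τ Λ,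
    c * Zeta F l ρ n (fun g => Γ (π g v)) f =
      Zeta F l ρ n (fun g => Γ (π g v)) (MOp F n f)

/-- The Bessel function of the conjugate representation `π^c`:
`B_{π^c,ψ}(g) = B_{π,ψ}(c·t̃⁻¹·g·t̃·c)`. -/
def BesselConj (l : ℕ) (ρ : F) (B : SO2l F l ρ → ℂ) : SO2l F l ρ → ℂ :=
  fun g => matFun (fun x : SO2l F l ρ => mat F x) B
    (cMat F l * (tTildeMat F l)⁻¹ * mat F g * tTildeMat F l * cMat F l)

section rows

omit [Fintype F]

/-- The standard basis row vector with a natural number index (zero out of range). -/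
def basisRow (N k : ℕ) : Fin N → F := fun j => if (j : ℕ) = k then 1 else 0

/-- The row of a matrix with a natural number index (zero out of range). -/
def natRow {N : ℕ} (A : Matrix (Fin N) (Fin N) F) (k : ℕ) : Fin N → F :=
  fun j => if h : k < N then A ⟨k, h⟩ j else 0

theorem natRow_mul {N : ℕ} (A B : Matrix (Fin N) (Fin N) F) (k : ℕ) :
    natRow F (A * B) k = natRow F A k ᵥ* B := by
  ext j
  by_cases h : k < N
  · simp [natRow, h, Matrix.mul_apply, Matrix.vecMul, dotProduct]
  · simp [natRow, h, Matrix.vecMul, dotProduct]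

theorem basisRow_vecMul {N : ℕ} (k : ℕ) (B : Matrix (Fin N) (Fin N) F) :
    basisRow F N k ᵥ* B = natRow F B k := by
  ext j
  by_cases h : k < N
  · have : basisRow F N k = Pi.single ⟨k, h⟩ 1 := by
      ext j; simp [basisRow, Pi.single_apply, Fin.ext_iff]
    simp [this, natRow, h]
  · have : basisRow F N k = 0 := by
      ext j
      have : (j : ℕ) ≠ k := by have := j.isLt; omega
      simp [basisRow, this]
    simp [this, natRow, h]

theorem ext_natRow {N : ℕ} {A B : Matrix (Fin N) (Fin N) F}
    (h : ∀ k < N, natRow F A k = natRow F B k) : A = B := by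
  ext i j
  have := congrFun (h i i.isLt) j
  simpa [natRow] using this

theorem natRow_one {N k : ℕ} (hk : k < N) :
    natRow F (1 : Matrix (Fin N) (Fin N) F) k = basisRow F N k := by
  ext j
  simp [natRow, basisRow, hk, Matrix.one_apply, Fin.ext_iff, eq_comm]

/-- The monomial matrix with `d i` in position `(i, τ i)`. -/
def monoMat (n : ℕ) (d : Fin n → F) (τ : Equiv.Perm (Fin n)) : Matrix (Fin n) (Fin n) F :=
  Matrix.of fun i j => if j = τ i then d i else 0

theorem permMat_eq_monoMat (n : ℕ) (σ : Equiv.Perm (Fin n)) :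
    permMat F n σ = monoMat F n (fun _ => 1) σ⁻¹ := by
  ext i j
  have : j = σ⁻¹ i ↔ σ j = i := Equiv.Perm.eq_inv_iff_eq
  simp only [permMat, monoMat, Matrix.of_apply, this]

theorem monoMat_mul_transpose (n : ℕ) (d : Fin n → F) (hd : ∀ i, d i ≠ 0)
    (τ : Equiv.Perm (Fin n)) :
    monoMat F n d τ * (monoMat F n (fun i => (d i)⁻¹) τ)ᵀ = 1 := by
  ext i j
  simp only [monoMat, Matrix.mul_apply, Matrix.transpose_apply, Matrix.of_apply, ite_mul,
    zero_mul, Finset.sum_ite_eq', Finset.mem_univ, if_true, Matrix.one_apply,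
    EmbeddingLike.apply_eq_iff_eq]
  by_cases h : i = j
  · simp [h, hd]
  · simp [h]

theorem inv_transpose_monoMat (n : ℕ) (d : Fin n → F) (hd : ∀ i, d i ≠ 0)
    (τ : Equiv.Perm (Fin n)) :
    ((monoMat F n d τ)⁻¹)ᵀ = monoMat F n (fun i => (d i)⁻¹) τ := by
  rw [Matrix.inv_eq_right_inv (monoMat_mul_transpose F n d hd τ), Matrix.transpose_transpose]

theorem Jmat_apply (m : ℕ) (i j : Fin m) : Jmat F m i j = if j = i.rev then 1 else 0 := by
  have : (i : ℕ) + j + 1 = m ↔ j = i.rev := by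
    rw [Fin.ext_iff, Fin.val_rev]; have := i.isLt; have := j.isLt; omega
  simp [Jmat, this]

theorem Jmat_mul_apply (m : ℕ) (A : Matrix (Fin m) (Fin m) F) (i j : Fin m) :
    (Jmat F m * A) i j = A i.rev j := by
  simp [Matrix.mul_apply, Jmat_apply]

theorem mul_Jmat_apply (m : ℕ) (A : Matrix (Fin m) (Fin m) F) (i j : Fin m) :
    (A * Jmat F m) i j = A i j.rev := by
  have h : ∀ x : Fin m, j = x.rev ↔ x = j.rev := fun x => by
    constructor <;> rintro rfl <;> simp
  simp [Matrix.mul_apply, Jmat_apply, h]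

theorem Jmat_mul_self (m : ℕ) : Jmat F m * Jmat F m = 1 := by
  ext i j
  rw [Jmat_mul_apply, Jmat_apply, Matrix.one_apply]
  simp [eq_comm]

theorem det_aStar_ne_zero (n : ℕ) (a : GL (Fin n) F) :
    (aStar F n (a : Matrix (Fin n) (Fin n) F)).det ≠ 0 := by
  have hJ : (Jmat F n).det ≠ 0 := by
    intro h
    have := congrArg Matrix.det (Jmat_mul_self F n)
    simp [h] at this
  have ha : (a : Matrix (Fin n) (Fin n) F).det ≠ 0 :=
    ((Matrix.isUnit_iff_isUnit_det _).1 a.isUnit).ne_zero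
  simp [aStar, Matrix.det_mul, hJ, Matrix.det_nonsing_inv, ha]

theorem aStar_monoMat_apply (n : ℕ) (d : Fin n → F) (hd : ∀ i, d i ≠ 0)
    (τ : Equiv.Perm (Fin n)) (i j : Fin n) :
    aStar F n (monoMat F n d τ) i j = if j = (τ i.rev).rev then (d i.rev)⁻¹ else 0 := by
  rw [aStar, mul_Jmat_apply, Jmat_mul_apply, inv_transpose_monoMat F n d hd]
  have : j.rev = τ i.rev ↔ j = (τ i.rev).rev := by
    rw [← Fin.rev_inj, Fin.rev_rev]
  simp [monoMat, this]

theorem natRow_tnMat_left {l n : ℕ} (hn : n < l) (σ : Equiv.Perm (Fin n)) (i : Fin n) :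
    natRow F (tnMat F l n (permMat F n σ)) i = basisRow F (2*l) (σ⁻¹ i : Fin n) := by
  have hi := i.isLt
  have hs := (σ⁻¹ i).isLt
  ext j
  simp only [natRow, basisRow, tnMat, permMat_eq_monoMat, monoMat, Matrix.of_apply, hi,
    dif_pos (show (i : ℕ) < 2 * l by omega), dif_pos, Fin.ext_iff]
  split_ifs <;> first | rfl | omega

theorem natRow_tnMat_mid {l n k : ℕ} (h1 : n ≤ k) (h2 : k < 2*l - n)
    (A : Matrix (Fin n) (Fin n) F) :
    natRow F (tnMat F l n A) k = basisRow F (2*l) k := by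
  ext j
  simp only [natRow, basisRow, tnMat, Matrix.of_apply, dif_pos (show k < 2 * l by omega),
    dif_neg (show ¬ k < n by omega), dif_pos h2, Fin.ext_iff, eq_comm]

theorem natRow_tnMat_right {l n : ℕ} (hn : n < l) (σ : Equiv.Perm (Fin n)) (i : Fin n) :
    natRow F (tnMat F l n (permMat F n σ)) (2*l - 1 - i) =
      basisRow F (2*l) (2*l - 1 - (σ⁻¹ i : Fin n)) := by
  have hi := i.isLt
  have hs := (σ⁻¹ i).isLt
  have hr : Fin.rev (⟨2*l - 1 - i - (2*l - n), by omega⟩ : Fin n) = i := by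
    rw [Fin.ext_iff, Fin.val_rev]; simp only; omega
  ext j
  have hj := j.isLt
  simp only [natRow, basisRow, tnMat, permMat_eq_monoMat, Matrix.of_apply,
    dif_pos (show 2*l - 1 - (i : ℕ) < 2 * l by omega),
    dif_neg (show ¬ 2*l - 1 - (i : ℕ) < n by omega),
    dif_neg (show ¬ 2*l - 1 - (i : ℕ) < 2*l - n by omega),
    aStar_monoMat_apply F n (fun _ => 1) (fun _ => one_ne_zero), hr, Fin.ext_iff, Fin.val_rev,
    inv_one]
  split_ifs <;> first | rfl | omega

theorem natRow_wTildeMat_left {l n k : ℕ} (hn : n < l) (hk : k < n) :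
    natRow F (wTildeMat F l n) k = basisRow F (2*l) (k + (2*l - n)) := by
  ext j
  simp [natRow, basisRow, wTildeMat, show k < 2 * l by omega, hk]

theorem natRow_wTildeMat_center {l n k : ℕ} (hn : n < l) (hk : k = l - 1) :
    natRow F (wTildeMat F l n) k = (-1 : F) ^ n • basisRow F (2*l) k := by
  subst hk
  ext j
  simp [natRow, basisRow, wTildeMat, show l - 1 < 2 * l by omega, show ¬ l - 1 < n by omega,
    Fin.ext_iff, eq_comm]

theorem natRow_wTildeMat_mid {l n k : ℕ} (h1 : l ≤ k) (h2 : k < 2*l - n) (hn : n < l) :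
    natRow F (wTildeMat F l n) k = basisRow F (2*l) k := by
  ext j
  simp [natRow, basisRow, wTildeMat, show k < 2 * l by omega, show ¬ k < n by omega,
    show ¬ k < l - 1 by omega, show ¬ k = l - 1 by omega, h2, Fin.ext_iff, eq_comm]

theorem natRow_wTildeMat_right {l n k : ℕ} (hn : n < l) (hk : k < n) :
    natRow F (wTildeMat F l n) (2*l - 1 - k) = basisRow F (2*l) (n - 1 - k) := by
  ext j
  have hj := j.isLt
  simp only [natRow, basisRow, wTildeMat, Matrix.of_apply, show 2*l - 1 - k < 2 * l by omega,
    dif_pos, show ¬ 2*l - 1 - k < n by omega, show ¬ 2*l - 1 - k < l - 1 by omega,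
    show ¬ 2*l - 1 - k = l - 1 by omega, show ¬ 2*l - 1 - k < 2*l - n by omega, if_false]
  split_ifs <;> first | rfl | omega

section torus

variable (l : ℕ) (ρ : F) (tv : ℕ → Fˣ) (a b : F)

theorem natRow_torusMat_left {k : ℕ} (hk : k < l - 1) :
    natRow F (torusMat F l ρ tv a b) k = (tv k : F) • basisRow F (2*l) k := by
  ext j
  simp [natRow, basisRow, torusMat, show k < 2 * l by omega, hk, Fin.ext_iff, eq_comm]

theorem natRow_torusMat_center {k : ℕ} (hl : 0 < l) (hk : k = l - 1) :
    natRow F (torusMat F l ρ tv a b) k =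
      a • basisRow F (2*l) (l - 1) + (b * ρ) • basisRow F (2*l) l := by
  subst hk
  ext j
  simp only [natRow, basisRow, torusMat, show l - 1 < 2 * l by omega, Matrix.of_apply, dif_pos,
    lt_irrefl, if_false, if_true, Pi.add_apply, Pi.smul_apply, smul_eq_mul]
  split_ifs <;> first | omega | simp

theorem natRow_torusMat_center_succ (hl : 0 < l) :
    natRow F (torusMat F l ρ tv a b) l =
      b • basisRow F (2*l) (l - 1) + a • basisRow F (2*l) l := by
  ext j
  simp only [natRow, basisRow, torusMat, show l < 2 * l by omega, Matrix.of_apply, dif_pos,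
    show ¬ l < l - 1 by omega, show ¬ l = l - 1 by omega,
    if_false, if_true, Pi.add_apply, Pi.smul_apply, smul_eq_mul]
  split_ifs <;> first | omega | simp

theorem natRow_torusMat_right {k : ℕ} (h1 : l < k) (hk : k < 2*l) :
    natRow F (torusMat F l ρ tv a b) k = ((tv (2*l - 1 - k))⁻¹ : F) • basisRow F (2*l) k := by
  ext j
  simp only [natRow, basisRow, torusMat, Matrix.of_apply, dif_pos hk, Pi.smul_apply, smul_eq_mul,
    Fin.ext_iff]
  split_ifs <;> first | omega | simp

end torus

/-- Insert a zero in position `l` into a row vector of length `2 * l`. -/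
def insRow (l : ℕ) (v : Fin (2*l) → F) : Fin (2*l+1) → F := fun j =>
  if hj : (j : ℕ) = l then 0
  else v ⟨if (j : ℕ) < l then (j : ℕ) else (j : ℕ) - 1, by have := j.isLt; split <;> omega⟩

theorem insRow_add (l : ℕ) (v w : Fin (2*l) → F) :
    insRow F l (v + w) = insRow F l v + insRow F l w := by
  ext j; by_cases h : (j : ℕ) = l <;> simp [insRow, h]

theorem insRow_smul (l : ℕ) (c : F) (v : Fin (2*l) → F) :
    insRow F l (c • v) = c • insRow F l v := by
  ext j; by_cases h : (j : ℕ) = l <;> simp [insRow, h]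

theorem insRow_basisRow_left {l k : ℕ} (hk : k < l) :
    insRow F l (basisRow F (2*l) k) = basisRow F (2*l+1) k := by
  ext j
  simp only [insRow, basisRow]
  split_ifs <;> first | rfl | omega

theorem insRow_basisRow_right {l k : ℕ} (hk : l ≤ k) :
    insRow F l (basisRow F (2*l) k) = basisRow F (2*l+1) (k + 1) := by
  ext j
  simp only [insRow, basisRow]
  split_ifs <;> first | rfl | omega

section insTop

variable {l : ℕ} (g : Matrix (Fin (2*l)) (Fin (2*l)) F)

theorem natRow_insTop_left {k : ℕ} (hk : k < l) :
    natRow F (insTop F l g) k = insRow F l (natRow F g k) := by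
  ext j
  simp only [natRow, insTop, insRow, Matrix.of_apply, dif_pos (show k < 2*l + 1 by omega),
    dif_pos (show k < 2*l by omega), dif_neg (show ¬ k = l by omega), if_pos hk]

theorem natRow_insTop_center : natRow F (insTop F l g) l = basisRow F (2*l+1) l := by
  ext j
  simp [natRow, insTop, basisRow, show l < 2*l + 1 by omega]

theorem natRow_insTop_right {k : ℕ} (h1 : l < k) (hk : k < 2*l + 1) :
    natRow F (insTop F l g) k = insRow F l (natRow F g (k - 1)) := by
  ext j
  simp only [natRow, insTop, insRow, Matrix.of_apply, dif_pos hk,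
    dif_pos (show k - 1 < 2*l by omega), dif_neg (show ¬ k = l by omega),
    if_neg (show ¬ k < l by omega)]

end insTop

section Mtop

variable (m : ℕ) (ρ : F)

theorem natRow_Mtop_left {k : ℕ} (hk : k < m) :
    natRow F (Mtop F (m+1) ρ) k = basisRow F (2*(m+1)+1) k := by
  ext j
  simp only [natRow, Mtop, basisRow, Matrix.of_apply, dif_pos (show k < 2*(m+1)+1 by omega),
    Fin.ext_iff]
  split_ifs <;> first | rfl | omega

theorem natRow_Mtop_right {k : ℕ} (h1 : m + 2 < k) (hk : k < 2*(m+1)+1) :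
    natRow F (Mtop F (m+1) ρ) k = basisRow F (2*(m+1)+1) k := by
  ext j
  simp only [natRow, Mtop, basisRow, Matrix.of_apply, dif_pos hk, Fin.ext_iff]
  split_ifs <;> first | rfl | omega

theorem natRow_Mtop_zero :
    natRow F (Mtop F (m+1) ρ) m = basisRow F (2*(m+1)+1) (m+1) := by
  ext j
  simp [natRow, Mtop, basisRow, show m < 2*(m+1)+1 by omega]

theorem natRow_Mtop_one (h2 : (2 : F) ≠ 0) :
    natRow F (Mtop F (m+1) ρ) (m+1) =
      (2 : F)⁻¹ • basisRow F (2*(m+1)+1) m + ρ⁻¹ • basisRow F (2*(m+1)+1) (m+2) := by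
  ext j
  simp only [natRow, Mtop, basisRow, show m + 1 < 2*(m+1)+1 by omega, Matrix.of_apply, dif_pos,
    show ¬ m + 1 + 2 = m + 1 + 1 by omega, if_false, if_true, Pi.add_apply, Pi.smul_apply,
    smul_eq_mul, mul_div_cancel₀ ρ h2]
  split_ifs <;> first | omega | simp

theorem natRow_Mtop_two (h2 : (2 : F) ≠ 0) :
    natRow F (Mtop F (m+1) ρ) (m+2) =
      (2 : F)⁻¹ • basisRow F (2*(m+1)+1) m - ρ⁻¹ • basisRow F (2*(m+1)+1) (m+2) := by
  ext j
  simp only [natRow, Mtop, basisRow, show m + 2 < 2*(m+1)+1 by omega, Matrix.of_apply, dif_pos,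
    show ¬ m + 2 + 2 = m + 1 + 1 by omega, show ¬ m + 2 = m + 1 by omega,
    if_false, if_true, Pi.sub_apply, Pi.smul_apply,
    smul_eq_mul, mul_div_cancel₀ ρ h2]
  split_ifs <;> first | omega | simp

/-- The inverse of `Mtop F (m+1) ρ`, described by its rows. -/
def MtopInv : Matrix (Fin (2*(m+1)+1)) (Fin (2*(m+1)+1)) F :=
  Matrix.of fun i =>
    if (i : ℕ) = m then basisRow F _ (m+1) + basisRow F _ (m+2)
    else if (i : ℕ) = m + 1 then basisRow F _ m
    else if (i : ℕ) = m + 2 then (ρ/2) • (basisRow F _ (m+1) - basisRow F _ (m+2))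
    else basisRow F _ i

theorem natRow_MtopInv {k : ℕ} (hk : k < 2*(m+1)+1) :
    natRow F (MtopInv F m ρ) k =
      if k = m then basisRow F _ (m+1) + basisRow F _ (m+2)
      else if k = m + 1 then basisRow F _ m
      else if k = m + 2 then (ρ/2) • (basisRow F _ (m+1) - basisRow F _ (m+2))
      else basisRow F _ k := by
  ext j
  simp [natRow, MtopInv, hk]

theorem MtopInv_mul_Mtop (h2 : (2 : F) ≠ 0) (hρ : ρ ≠ 0) :
    MtopInv F m ρ * Mtop F (m+1) ρ = 1 := by
  apply ext_natRow
  intro k hk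
  rw [natRow_mul, natRow_MtopInv F m ρ hk, natRow_one F hk]
  split_ifs with h h' h''
  · rw [Matrix.add_vecMul, basisRow_vecMul, basisRow_vecMul, natRow_Mtop_one F m ρ h2,
      natRow_Mtop_two F m ρ h2, h]
    match_scalars <;> field_simp <;> ring
  · rw [basisRow_vecMul, natRow_Mtop_zero, h']
  · rw [Matrix.smul_vecMul, Matrix.sub_vecMul, basisRow_vecMul, basisRow_vecMul,
      natRow_Mtop_one F m ρ h2, natRow_Mtop_two F m ρ h2, h'']
    match_scalars <;> field_simp <;> ring
  · rw [basisRow_vecMul]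
    rcases lt_or_gt_of_ne h with h0 | h0
    · exact natRow_Mtop_left F m ρ h0
    · exact natRow_Mtop_right F m ρ (by omega) hk

theorem embTop_eq (h2 : (2 : F) ≠ 0) (hρ : ρ ≠ 0)
    (g : Matrix (Fin (2*(m+1))) (Fin (2*(m+1))) F) :
    embTop F (m+1) ρ g = MtopInv F m ρ * insTop F (m+1) g * Mtop F (m+1) ρ := by
  rw [embTop, Matrix.inv_eq_left_inv (MtopInv_mul_Mtop F m ρ h2 hρ)]

end Mtop

section siegel

theorem natRow_wnOddMat_left {l k : ℕ} (hk : k < l) :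
    natRow F (wnOddMat F l) k = basisRow F (2*l+1) (k + l + 1) := by
  ext j
  simp [natRow, basisRow, wnOddMat, show k < 2 * l + 1 by omega, hk]

theorem natRow_wnOddMat_center (l : ℕ) :
    natRow F (wnOddMat F l) l = (-1 : F) ^ l • basisRow F (2*l+1) l := by
  ext j
  simp [natRow, basisRow, wnOddMat, show l < 2 * l + 1 by omega, Fin.ext_iff, eq_comm]

theorem natRow_wnOddMat_right {l k : ℕ} (hk : k < l) :
    natRow F (wnOddMat F l) (k + l + 1) = basisRow F (2*l+1) k := by
  ext j
  simp [natRow, basisRow, wnOddMat, show k + l + 1 < 2 * l + 1 by omega,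
    show ¬ k + l + 1 < l by omega, show ¬ k + l + 1 = l by omega]

theorem natRow_lnMat_left {l : ℕ} (d : Fin l → F) (τ : Equiv.Perm (Fin l)) (i : Fin l) :
    natRow F (lnMat F l (monoMat F l d τ)) i = d i • basisRow F (2*l+1) (τ i : Fin l) := by
  have hi := i.isLt
  have hs := (τ i).isLt
  ext j
  simp only [natRow, basisRow, lnMat, monoMat, Matrix.of_apply, hi,
    dif_pos (show (i : ℕ) < 2 * l + 1 by omega), dif_pos, Fin.ext_iff, Pi.smul_apply, smul_eq_mul]
  split_ifs <;> first | omega | simp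

theorem natRow_lnMat_center (l : ℕ) (A : Matrix (Fin l) (Fin l) F) :
    natRow F (lnMat F l A) l = basisRow F (2*l+1) l := by
  ext j
  simp [natRow, basisRow, lnMat, show l < 2 * l + 1 by omega, Fin.ext_iff, eq_comm]

theorem natRow_lnMat_right {l : ℕ} (d : Fin l → F) (hd : ∀ i, d i ≠ 0)
    (τ : Equiv.Perm (Fin l)) (i : Fin l) :
    natRow F (lnMat F l (monoMat F l d τ)) (2*l - i) =
      (d i)⁻¹ • basisRow F (2*l+1) (2*l - (τ i : Fin l)) := by
  have hi := i.isLt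
  have hs := (τ i).isLt
  have hr : Fin.rev (⟨2*l - i - (l + 1), by omega⟩ : Fin l) = i := by
    rw [Fin.ext_iff, Fin.val_rev]; simp only; omega
  ext j
  have hj := j.isLt
  simp only [natRow, basisRow, lnMat, Matrix.of_apply,
    dif_pos (show 2*l - (i : ℕ) < 2 * l + 1 by omega),
    dif_neg (show ¬ 2*l - (i : ℕ) < l by omega),
    dif_neg (show ¬ 2*l - (i : ℕ) = l by omega),
    aStar_monoMat_apply F l d hd, hr, Fin.ext_iff, Fin.val_rev, Pi.smul_apply, smul_eq_mul]
  split_ifs <;> first | omega | simp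

/-- The lower left block of an element `l_l(a) u₁ w_l u₂` of the big cell is `a^*`. -/
theorem siegel_cell_lower_left {l : ℕ} (A : Matrix (Fin l) (Fin l) F)
    {u₁ u₂ : Matrix (Fin (2*l+1)) (Fin (2*l+1)) F} (hu₁ : u₁ ∈ VnSet F l) (hu₂ : u₂ ∈ VnSet F l)
    (i j : Fin l) :
    (lnMat F l A * u₁ * wnOddMat F l * u₂) ⟨i + l + 1, by omega⟩ ⟨j, by omega⟩ =
      aStar F l A i j := by
  have e₂ : ∀ k, (wnOddMat F l * u₂) k ⟨j, by omega⟩ =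
      if k = ⟨j + l + 1, by omega⟩ then 1 else 0 := by
    intro k
    have : ∀ x, u₂ x ⟨j, by omega⟩ = if x = ⟨j, by omega⟩ then 1 else 0 := fun x =>
      hu₂.2 x ⟨j, by omega⟩ (by simp [blkSiegel])
    simp only [Matrix.mul_apply, this, mul_ite, mul_one, mul_zero, Finset.sum_ite_eq',
      Finset.mem_univ, if_true]
    simp only [wnOddMat, Matrix.of_apply, Fin.ext_iff]
    split_ifs <;> first | rfl | omega
  have e₁ : ∀ k, (lnMat F l A) ⟨i + l + 1, by omega⟩ k ≠ 0 →
      u₁ k ⟨j + l + 1, by omega⟩ = if k = ⟨j + l + 1, by omega⟩ then 1 else 0 := by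
    intro k hk
    apply hu₁.2
    have : l + 1 ≤ (k : ℕ) := by
      by_contra h
      apply hk
      simp [lnMat, show ¬ (i : ℕ) + l + 1 < l by omega, show ¬ (i : ℕ) + l + 1 = l by omega,
        show ¬ l < (k : ℕ) by omega]
    simp only [blkSiegel]
    split_ifs <;> omega
  rw [Matrix.mul_assoc, Matrix.mul_apply]
  simp only [e₂, mul_ite, mul_one, mul_zero, Finset.sum_ite_eq', Finset.mem_univ, if_true]
  rw [Matrix.mul_apply, Finset.sum_eq_single ⟨j + l + 1, by omega⟩]
  · by_cases h : (lnMat F l A) ⟨i + l + 1, by omega⟩ ⟨j + l + 1, by omega⟩ = 0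
    · have h' := h
      simp only [lnMat, Matrix.of_apply, show ¬ (i : ℕ) + l + 1 < l by omega,
        show ¬ (i : ℕ) + l + 1 = l by omega, dif_neg, not_false_eq_true,
        dif_pos (show l + 1 ≤ (j : ℕ) + l + 1 by omega)] at h'
      rw [h, zero_mul, ← h']
      congr 1 <;> (ext; simp only; omega)
    · rw [e₁ _ h, if_pos rfl, mul_one]
      simp only [lnMat, Matrix.of_apply, show ¬ (i : ℕ) + l + 1 < l by omega,
        show ¬ (i : ℕ) + l + 1 = l by omega, dif_neg, not_false_eq_true,
        dif_pos (show l + 1 ≤ (j : ℕ) + l + 1 by omega)]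
      congr 1 <;> (ext; simp only; omega)
  · intro k _ hk
    by_cases h : (lnMat F l A) ⟨i + l + 1, by omega⟩ k = 0
    · rw [h, zero_mul]
    · rw [e₁ _ h, if_neg hk, mul_zero]
  · simp

/-- A matrix having a row below the middle one which vanishes in the first `l` columns
is not in the big cell. -/
theorem not_mem_siegel_cell {l k : ℕ} (hl : l < k) (hk : k < 2*l+1)
    (X : Matrix (Fin (2*l+1)) (Fin (2*l+1)) F)
    (hX : ∀ j : Fin (2*l+1), (j : ℕ) < l → natRow F X k j = 0) (A : GL (Fin l) F)
    {u₁ u₂ : Matrix (Fin (2*l+1)) (Fin (2*l+1)) F} (hu₁ : u₁ ∈ VnSet F l) (hu₂ : u₂ ∈ VnSet F l) :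
    X ≠ lnMat F l (A : Matrix (Fin l) (Fin l) F) * u₁ * wnOddMat F l * u₂ := by
  rintro rfl
  refine det_aStar_ne_zero F l A (Matrix.det_eq_zero_of_row_eq_zero ⟨k - (l+1), by omega⟩ ?_)
  intro j
  rw [← siegel_cell_lower_left F (A : Matrix (Fin l) (Fin l) F) hu₁ hu₂]
  have := hX ⟨j, by omega⟩ (by simp)
  rw [natRow, dif_pos hk] at this
  rw [← this]
  exact congrFun (congrArg _ (Fin.ext (show k - (l + 1) + l + 1 = k by omega))) _

/-- The short root unipotent element of `SO_{2l+1}` in the Siegel radical attached to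
the `p`-th coordinate. -/
def siegelShort (l p : ℕ) (μ : F) : Matrix (Fin (2*l+1)) (Fin (2*l+1)) F :=
  Matrix.of fun i =>
    if (i : ℕ) = p then
      basisRow F _ p + μ • basisRow F _ l - (μ^2/2) • basisRow F _ (2*l - p)
    else if (i : ℕ) = l then basisRow F _ l - μ • basisRow F _ (2*l - p)
    else basisRow F _ i

theorem natRow_siegelShort {l k : ℕ} (p : ℕ) (μ : F) (hk : k < 2*l+1) :
    natRow F (siegelShort F l p μ) k =
      if k = p then
        basisRow F _ p + μ • basisRow F _ l - (μ^2/2) • basisRow F _ (2*l - p)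
      else if k = l then basisRow F _ l - μ • basisRow F _ (2*l - p)
      else basisRow F _ k := by
  ext j
  simp [natRow, siegelShort, hk]

theorem natRow_Jmat {l k : ℕ} (hk : k < 2*l+1) :
    natRow F (Jmat F (2*l+1)) k = basisRow F _ (2*l - k) := by
  ext j
  have hj := j.isLt
  simp only [natRow, Jmat, basisRow, Matrix.of_apply, dif_pos hk]
  split_ifs <;> first | rfl | omega

theorem siegelShort_mem_VnSet {l p : ℕ} (hp : p < l) (μ : F) (h2 : (2 : F) ≠ 0) :
    siegelShort F l p μ ∈ VnSet F l := by
  have hblk : ∀ i j : Fin (2*l+1), blkSiegel l (j : ℕ) ≤ blkSiegel l (i : ℕ) →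
      siegelShort F l p μ i j = if i = j then 1 else 0 := by
    intro i j h
    simp only [blkSiegel] at h
    simp only [siegelShort, Matrix.of_apply, Fin.ext_iff]
    split_ifs at h <;> split_ifs <;> first
      | omega
      | (simp only [basisRow, Pi.add_apply, Pi.sub_apply, Pi.smul_apply]
         split_ifs <;> first | omega | simp)
  refine ⟨⟨?_, ?_⟩, hblk⟩
  · rw [Matrix.det_of_isUpperTriangular]
    · refine Finset.prod_eq_one fun i _ => ?_
      rw [hblk i i le_rfl, if_pos rfl]
    · intro i j hij
      have hij' : (j : ℕ) < i := hij
      rw [hblk i j (by simp only [blkSiegel]; split_ifs <;> omega),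
        if_neg (by rintro rfl; simp at hij')]
  · have hinv : siegelShort F l p (-μ) * siegelShort F l p μ = 1 := by
      apply ext_natRow
      intro k hk
      rw [natRow_mul, natRow_siegelShort F p _ hk, natRow_one F hk]
      split_ifs with h h'
      · simp only [Matrix.sub_vecMul, Matrix.add_vecMul, Matrix.smul_vecMul, basisRow_vecMul]
        rw [natRow_siegelShort F p _ (by omega), natRow_siegelShort F p _ (by omega),
          natRow_siegelShort F p _ (by omega)]
        rw [if_pos rfl, if_neg (by omega), if_pos rfl, if_neg (by omega), if_neg (by omega), h]
        match_scalars <;> field_simp <;> ring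
      · simp only [Matrix.sub_vecMul, Matrix.smul_vecMul, basisRow_vecMul]
        rw [natRow_siegelShort F p _ (by omega), natRow_siegelShort F p _ (by omega)]
        rw [if_neg (by omega), if_pos rfl, if_neg (by omega), if_neg (by omega), h']
        match_scalars <;> ring
      · rw [basisRow_vecMul, natRow_siegelShort F p _ hk, if_neg h, if_neg h']
    have hJ : (siegelShort F l p μ)ᵀ * Jmat F (2*l+1) =
        Jmat F (2*l+1) * siegelShort F l p (-μ) := by
      ext i j
      have hi := i.isLt
      have hj := j.isLt
      rw [Jmat_mul_apply, mul_Jmat_apply]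
      simp only [Matrix.transpose_apply, siegelShort, Matrix.of_apply, Fin.val_rev]
      split_ifs <;> first
        | omega
        | (simp only [basisRow, Pi.add_apply, Pi.sub_apply, Pi.smul_apply]
           split_ifs <;> first | omega | simp)
    rw [hJ, Matrix.mul_assoc, hinv, Matrix.mul_one]

end siegel



theorem four_ne_zero_of_two_ne_zero (h2 : (2 : F) ≠ 0) : (4 : F) ≠ 0 := by
  rw [show (4 : F) = 2 * 2 by norm_num]
  exact mul_ne_zero h2 h2

section embedding

/-- The permutation of `Fin (m+1)` sending the last element to `0` and
acting by `i ↦ σ i + 1` otherwise. -/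
def shiftPerm {m : ℕ} (σ : Equiv.Perm (Fin m)) : Equiv.Perm (Fin (m+1)) :=
  Equiv.ofBijective (Fin.lastCases 0 fun i => (σ i).succ) <| by
    apply Function.Injective.bijective_of_finite
    intro x y
    refine Fin.lastCases ?_ (fun i => ?_) x <;> refine Fin.lastCases ?_ (fun j => ?_) y <;>
      simp [Fin.succ_ne_zero, (Fin.succ_ne_zero _).symm]

theorem shiftPerm_last {m : ℕ} (σ : Equiv.Perm (Fin m)) : shiftPerm σ (Fin.last m) = 0 := by
  simp [shiftPerm]

theorem shiftPerm_castSucc {m : ℕ} (σ : Equiv.Perm (Fin m)) (i : Fin m) :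
    shiftPerm σ i.castSucc = (σ i).succ := by
  simp [shiftPerm]

variable (m : ℕ) (ρ : F) (tv : ℕ → Fˣ) (a b : F)

/-- The element `t·w` of the cell `B_n`. -/
def torusWeyl {n : ℕ} (σ : Equiv.Perm (Fin n)) : Matrix (Fin (2*(m+1))) (Fin (2*(m+1))) F :=
  torusMat F (m+1) ρ tv a b * (tnMat F (m+1) n (permMat F n σ) * wTildeMat F (m+1) n)

variable {n : ℕ} (hn : n ≤ m) (σ : Equiv.Perm (Fin n))

include hn

theorem natRow_torusWeyl_left (i : Fin n) :
    natRow F (torusWeyl F m ρ tv a b σ) i =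
      (tv i : F) • basisRow F _ ((σ⁻¹ i : Fin n) + (2*(m+1) - n)) := by
  rw [torusWeyl, natRow_mul, natRow_torusMat_left F _ _ _ _ _ (by omega), Matrix.smul_vecMul,
    basisRow_vecMul, natRow_mul, natRow_tnMat_left F (by omega), basisRow_vecMul,
    natRow_wTildeMat_left F (by omega) (by omega)]

theorem natRow_torusWeyl_center :
    natRow F (torusWeyl F m ρ tv a b σ) m =
      (a * (-1) ^ n) • basisRow F _ m + (b * ρ) • basisRow F _ (m+1) := by
  rw [torusWeyl, natRow_mul, natRow_torusMat_center F _ _ _ _ _ (by omega) (by omega),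
    Matrix.add_vecMul, Matrix.smul_vecMul, Matrix.smul_vecMul, basisRow_vecMul, basisRow_vecMul,
    natRow_mul, natRow_mul, natRow_tnMat_mid F (by omega) (by omega),
    natRow_tnMat_mid F (by omega) (by omega), basisRow_vecMul, basisRow_vecMul,
    natRow_wTildeMat_center F (by omega) rfl, natRow_wTildeMat_mid F (by omega) (by omega) (by omega),
    smul_smul, Nat.add_sub_cancel]

theorem natRow_torusWeyl_center_succ :
    natRow F (torusWeyl F m ρ tv a b σ) (m+1) =
      (b * (-1) ^ n) • basisRow F _ m + a • basisRow F _ (m+1) := by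
  rw [torusWeyl, natRow_mul, natRow_torusMat_center_succ F _ _ _ _ _ (by omega),
    Matrix.add_vecMul, Matrix.smul_vecMul, Matrix.smul_vecMul, basisRow_vecMul, basisRow_vecMul,
    natRow_mul, natRow_mul, natRow_tnMat_mid F (by omega) (by omega),
    natRow_tnMat_mid F (by omega) (by omega), basisRow_vecMul, basisRow_vecMul,
    natRow_wTildeMat_center F (by omega) rfl, natRow_wTildeMat_mid F (by omega) (by omega) (by omega),
    smul_smul, Nat.add_sub_cancel]

theorem natRow_torusWeyl_mid {k : ℕ} (h1 : m + 1 < k) (hk : k < 2*(m+1) - n) :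
    natRow F (torusWeyl F m ρ tv a b σ) k =
      ((tv (2*(m+1) - 1 - k))⁻¹ : F) • basisRow F _ k := by
  rw [torusWeyl, natRow_mul, natRow_torusMat_right F _ _ _ _ _ h1 (by omega), Matrix.smul_vecMul,
    basisRow_vecMul, natRow_mul, natRow_tnMat_mid F (by omega) (by omega), basisRow_vecMul,
    natRow_wTildeMat_mid F (by omega) (by omega) (by omega)]

theorem natRow_torusWeyl_right (i : Fin n) :
    natRow F (torusWeyl F m ρ tv a b σ) (2*(m+1) - 1 - i) =
      ((tv i)⁻¹ : F) • basisRow F _ (n - 1 - (σ⁻¹ i : Fin n)) := by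
  rw [torusWeyl, natRow_mul, natRow_torusMat_right F _ _ _ _ _ (by omega) (by omega),
    Matrix.smul_vecMul, basisRow_vecMul, natRow_mul, natRow_tnMat_right F (by omega),
    basisRow_vecMul, natRow_wTildeMat_right F (by omega) (by omega),
    show 2*(m+1) - 1 - (2*(m+1) - 1 - (i : ℕ)) = i by omega]

variable (h2 : (2 : F) ≠ 0) (hρ : ρ ≠ 0)

include h2 hρ

theorem natRow_embTop_left (i : Fin n) :
    natRow F (embTop F (m+1) ρ (torusWeyl F m ρ tv a b σ)) i =
      (tv i : F) • basisRow F _ ((σ⁻¹ i : Fin n) + (2*(m+1) - n) + 1) := by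
  have hi := i.isLt
  have hs := (σ⁻¹ i).isLt
  rw [embTop_eq F m ρ h2 hρ, natRow_mul, natRow_mul, natRow_MtopInv F m ρ (by omega),
    if_neg (by omega), if_neg (by omega), if_neg (by omega), basisRow_vecMul,
    natRow_insTop_left F _ (by omega), natRow_torusWeyl_left F m ρ tv a b hn, insRow_smul,
    insRow_basisRow_right F (by omega), Matrix.smul_vecMul, basisRow_vecMul,
    natRow_Mtop_right F m ρ (by omega) (by omega)]

theorem natRow_embTop_right (i : Fin n) :
    natRow F (embTop F (m+1) ρ (torusWeyl F m ρ tv a b σ)) (2*(m+1) - i) =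
      ((tv i)⁻¹ : F) • basisRow F _ (n - 1 - (σ⁻¹ i : Fin n)) := by
  have hi := i.isLt
  have hs := (σ⁻¹ i).isLt
  rw [embTop_eq F m ρ h2 hρ, natRow_mul, natRow_mul, natRow_MtopInv F m ρ (by omega),
    if_neg (by omega), if_neg (by omega), if_neg (by omega), basisRow_vecMul,
    natRow_insTop_right F _ (by omega) (by omega),
    show 2*(m+1) - (i : ℕ) - 1 = 2*(m+1) - 1 - i by omega,
    natRow_torusWeyl_right F m ρ tv a b hn, insRow_smul,
    insRow_basisRow_left F (by omega), Matrix.smul_vecMul, basisRow_vecMul,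
    natRow_Mtop_left F m ρ (by omega)]

theorem natRow_embTop_mid {k : ℕ} (h1 : m + 2 < k) (hk : k < 2*(m+1) - n + 1) :
    natRow F (embTop F (m+1) ρ (torusWeyl F m ρ tv a b σ)) k =
      ((tv (2*(m+1) - k))⁻¹ : F) • basisRow F _ k := by
  rw [embTop_eq F m ρ h2 hρ, natRow_mul, natRow_mul, natRow_MtopInv F m ρ (by omega),
    if_neg (by omega), if_neg (by omega), if_neg (by omega), basisRow_vecMul,
    natRow_insTop_right F _ (by omega) (by omega),
    natRow_torusWeyl_mid F m ρ tv a b hn σ (by omega) (by omega), insRow_smul,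
    insRow_basisRow_right F (by omega), Matrix.smul_vecMul, basisRow_vecMul,
    natRow_Mtop_right F m ρ (by omega) (by omega), show k - 1 + 1 = k by omega,
    show 2*(m+1) - 1 - (k - 1) = 2*(m+1) - k by omega]

theorem natRow_insTop_mul_Mtop_two :
    natRow F (insTop F (m+1) (torusWeyl F m ρ tv a b σ)) (m+2) ᵥ* Mtop F (m+1) ρ =
      (a/2) • basisRow F _ m + (b * (-1) ^ n) • basisRow F _ (m+1) -
        (a/ρ) • basisRow F _ (m+2) := by
  rw [natRow_insTop_right F _ (by omega) (by omega), Nat.add_sub_assoc (by omega),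
    natRow_torusWeyl_center_succ F m ρ tv a b hn, insRow_add, insRow_smul, insRow_smul,
    insRow_basisRow_left F (by omega), insRow_basisRow_right F (by omega), Matrix.add_vecMul,
    Matrix.smul_vecMul, Matrix.smul_vecMul, basisRow_vecMul, basisRow_vecMul, natRow_Mtop_zero,
    natRow_Mtop_two F m ρ h2]
  match_scalars <;> field_simp

theorem natRow_embTop_zero :
    natRow F (embTop F (m+1) ρ (torusWeyl F m ρ tv a b σ)) m =
      ((1 + a)/2) • basisRow F _ m + (b * (-1) ^ n) • basisRow F _ (m+1) +
        ((1 - a)/ρ) • basisRow F _ (m+2) := by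
  rw [embTop_eq F m ρ h2 hρ, natRow_mul, natRow_mul, natRow_MtopInv F m ρ (by omega),
    if_pos rfl, Matrix.add_vecMul, basisRow_vecMul, basisRow_vecMul, Matrix.add_vecMul,
    natRow_insTop_mul_Mtop_two F m ρ tv a b hn σ h2 hρ, natRow_insTop_center, basisRow_vecMul,
    natRow_Mtop_one F m ρ h2]
  match_scalars <;> field_simp <;> ring

theorem natRow_embTop_one :
    natRow F (embTop F (m+1) ρ (torusWeyl F m ρ tv a b σ)) (m+1) =
      (b*ρ/2) • basisRow F _ m + (a * (-1) ^ n) • basisRow F _ (m+1) -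
        b • basisRow F _ (m+2) := by
  rw [embTop_eq F m ρ h2 hρ, natRow_mul, natRow_mul, natRow_MtopInv F m ρ (by omega),
    if_neg (by omega), if_pos rfl, basisRow_vecMul, natRow_insTop_left F _ (by omega),
    natRow_torusWeyl_center F m ρ tv a b hn, insRow_add, insRow_smul, insRow_smul,
    insRow_basisRow_left F (by omega), insRow_basisRow_right F (by omega), Matrix.add_vecMul,
    Matrix.smul_vecMul, Matrix.smul_vecMul, basisRow_vecMul, basisRow_vecMul, natRow_Mtop_zero,
    natRow_Mtop_two F m ρ h2]
  match_scalars <;> field_simp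

theorem natRow_embTop_two :
    natRow F (embTop F (m+1) ρ (torusWeyl F m ρ tv a b σ)) (m+2) =
      (ρ*(1 - a)/4) • basisRow F _ m - (ρ/2 * b * (-1) ^ n) • basisRow F _ (m+1) +
        ((1 + a)/2) • basisRow F _ (m+2) := by
  have h4 : (4 : F) ≠ 0 := four_ne_zero_of_two_ne_zero F h2
  rw [embTop_eq F m ρ h2 hρ, natRow_mul, natRow_mul, natRow_MtopInv F m ρ (by omega),
    if_neg (by omega), if_neg (by omega), if_pos rfl, Matrix.smul_vecMul, Matrix.smul_vecMul,
    Matrix.sub_vecMul, basisRow_vecMul, basisRow_vecMul, Matrix.sub_vecMul,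
    natRow_insTop_mul_Mtop_two F m ρ tv a b hn σ h2 hρ, natRow_insTop_center, basisRow_vecMul,
    natRow_Mtop_one F m ρ h2]
  match_scalars <;> field_simp <;> ring

omit hn

/-- The nonzero entries of the Levi component in the big cell factorization of `t·w`. -/
def cellDiag : Fin (m+1) → F := Fin.lastCases (ρ*(1 - a)/4)⁻¹ fun i => (tv i : F)

omit h2 hρ in
theorem cellDiag_last : cellDiag F m ρ tv a (Fin.last m) = (ρ*(1 - a)/4)⁻¹ := by
  simp [cellDiag]

omit h2 hρ in
theorem cellDiag_castSucc (i : Fin m) : cellDiag F m ρ tv a i.castSucc = tv i := by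
  simp [cellDiag]

theorem cellDiag_ne_zero (ha : a ≠ 1) (i : Fin (m+1)) : cellDiag F m ρ tv a i ≠ 0 := by
  have h4 : (4 : F) ≠ 0 := four_ne_zero_of_two_ne_zero F h2
  refine Fin.lastCases ?_ (fun i => ?_) i
  · rw [cellDiag_last]
    exact inv_ne_zero (div_ne_zero (mul_ne_zero hρ (sub_ne_zero.2 ha.symm)) h4)
  · rw [cellDiag_castSucc]
    exact Units.ne_zero _

/-- The big cell factorization of the embedding of `t·w` for `w` in the cell `B_{l-1}`. -/
theorem embTop_eq_siegel_cell (σ : Equiv.Perm (Fin m)) (hab : a ^ 2 - b ^ 2 * ρ = 1)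
    (ha : a ≠ 1) :
    embTop F (m+1) ρ (torusWeyl F m ρ tv a b σ) =
      lnMat F (m+1) (monoMat F (m+1) (cellDiag F m ρ tv a) (shiftPerm σ⁻¹)) *
      siegelShort F (m+1) 0 (-(ρ*b/2)) * wnOddMat F (m+1) *
      siegelShort F (m+1) m (-(2*(-1)^m*b/(1-a))) := by
  have h4 : (4 : F) ≠ 0 := four_ne_zero_of_two_ne_zero F h2
  have ha' : 1 - a ≠ 0 := sub_ne_zero.2 ha.symm
  have hε : ((-1 : F)^m)^2 = 1 := by rw [← pow_mul, mul_comm, pow_mul]; simp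
  have hd := cellDiag_ne_zero F m ρ tv a h2 hρ ha
  have hd_last := cellDiag_last F m ρ tv a
  have hd_cast := cellDiag_castSucc F m ρ tv a
  apply ext_natRow
  intro k hk
  have hshort : ∀ {p j : ℕ} (μ : F), j < 2*(m+1)+1 → j ≠ p → j ≠ m + 1 →
      natRow F (siegelShort F (m+1) p μ) j = basisRow F _ j := by
    intro p j μ hj h h'
    rw [natRow_siegelShort F p μ hj, if_neg h, if_neg h']
  have hone : ∀ {p : ℕ} (μ : F), p < m + 1 → natRow F (siegelShort F (m+1) p μ) (m+1) =
      basisRow F _ (m+1) - μ • basisRow F _ (2*(m+1) - p) := by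
    intro p μ hp
    rw [natRow_siegelShort F p μ (by omega), if_neg (by omega), if_pos rfl]
  have hzero : ∀ {p : ℕ} (μ : F), p < m + 1 → natRow F (siegelShort F (m+1) p μ) p =
      basisRow F _ p + μ • basisRow F _ (m+1) - (μ^2/2) • basisRow F _ (2*(m+1) - p) := by
    intro p μ hp
    rw [natRow_siegelShort F p μ (by omega), if_pos rfl]
  have hw_first : natRow F (wnOddMat F (m+1)) (2*(m+1)) = basisRow F _ m := by
    have h := natRow_wnOddMat_right F (l := m + 1) (Nat.lt_succ_self m)
    rwa [show m + (m+1) + 1 = 2*(m+1) by omega] at h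
  rw [natRow_mul, natRow_mul, natRow_mul]
  rcases lt_trichotomy k m with hkm | rfl | hkm
  · have hL := natRow_lnMat_left F (cellDiag F m ρ tv a) (shiftPerm σ⁻¹) (Fin.castSucc ⟨k, hkm⟩)
    have hX := natRow_embTop_left F m ρ tv a b le_rfl σ h2 hρ ⟨k, hkm⟩
    rw [hd_cast, shiftPerm_castSucc, Fin.val_succ, Fin.val_castSucc] at hL
    simp only at hL hX
    have hs := (σ⁻¹ ⟨k, hkm⟩).isLt
    rw [hL, hX, Matrix.smul_vecMul, basisRow_vecMul, hshort _ (by omega) (by omega) (by omega),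
      Matrix.smul_vecMul, basisRow_vecMul, natRow_wnOddMat_left F (by omega), Matrix.smul_vecMul,
      basisRow_vecMul, hshort _ (by omega) (by omega) (by omega)]
    congr 2
    omega
  · have hL := natRow_lnMat_left F (cellDiag F k ρ tv a) (shiftPerm σ⁻¹) (Fin.last k)
    rw [hd_last, shiftPerm_last, Fin.val_last, Fin.val_zero] at hL
    rw [hL, natRow_embTop_zero F k ρ tv a b le_rfl σ h2 hρ, Matrix.smul_vecMul, basisRow_vecMul,
      hzero _ (by omega)]
    simp only [Matrix.sub_vecMul, Matrix.add_vecMul, Matrix.smul_vecMul, basisRow_vecMul,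
      Nat.sub_zero]
    rw [natRow_wnOddMat_left F (by omega), natRow_wnOddMat_center, hw_first]
    simp only [Matrix.smul_vecMul, basisRow_vecMul]
    rw [hshort _ (by omega) (by omega) (by omega), hone _ (by omega), hzero _ (by omega),
      show 0 + (k + 1) + 1 = k + 2 by omega, show 2*(k+1) - k = k + 2 by omega, pow_succ]
    generalize (-1 : F)^k = ε at hε ⊢
    match_scalars
    · field_simp
      linear_combination (-4) * hab
    · field_simp
      linear_combination 4 * b * ε * hab
    · field_simp
      linear_combination 4 * ((1 - a)^2 + 2*(1 - a) + ρ*b^2) * hab -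
        4 * (4 * (1 - a) * ρ * b^2 + ρ^2 * b^4) * hε
  · rcases eq_or_ne k (m+1) with rfl | hkm1
    · rw [natRow_lnMat_center, natRow_embTop_one F m ρ tv a b le_rfl σ h2 hρ, basisRow_vecMul,
        hone _ (by omega), Nat.sub_zero]
      simp only [Matrix.sub_vecMul, Matrix.smul_vecMul, basisRow_vecMul]
      rw [natRow_wnOddMat_center, hw_first]
      simp only [Matrix.smul_vecMul, basisRow_vecMul]
      rw [hone _ (by omega), hzero _ (by omega), show 2*(m+1) - m = m + 2 by omega, pow_succ]
      generalize (-1 : F)^m = ε at hε ⊢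
      match_scalars
      · field_simp
      · field_simp
        linear_combination -ε * hab
      · field_simp
        linear_combination b * (2*(1 - a) + ρ*b^2) * hε - b * hab
    · rcases eq_or_ne k (m+2) with rfl | hkm2
      · have hL := natRow_lnMat_right F (cellDiag F m ρ tv a) hd (shiftPerm σ⁻¹) (Fin.last m)
        rw [hd_last, shiftPerm_last, Fin.val_last, Fin.val_zero, Nat.sub_zero,
          show 2*(m+1) - m = m + 2 by omega] at hL
        rw [hL, natRow_embTop_two F m ρ tv a b le_rfl σ h2 hρ, Matrix.smul_vecMul, basisRow_vecMul,
          hshort _ (by omega) (by omega) (by omega), Matrix.smul_vecMul, basisRow_vecMul, hw_first,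
          Matrix.smul_vecMul, basisRow_vecMul, hzero _ (by omega),
          show 2*(m+1) - m = m + 2 by omega]
        generalize (-1 : F)^m = ε at hε ⊢
        match_scalars
        · field_simp
        · field_simp
          ring
        · field_simp
          linear_combination 4 * ρ * b^2 * hε - 4 * hab
      · have hi : 2*(m+1) - k < m := by omega
        have hL := natRow_lnMat_right F (cellDiag F m ρ tv a) hd (shiftPerm σ⁻¹) (Fin.castSucc ⟨2*(m+1) - k, hi⟩)
        have hX := natRow_embTop_right F m ρ tv a b le_rfl σ h2 hρ ⟨2*(m+1) - k, hi⟩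
        rw [hd_cast, shiftPerm_castSucc, Fin.val_succ, Fin.val_castSucc] at hL
        simp only [show 2*(m+1) - (2*(m+1) - k) = k by omega] at hL hX
        have hs := (σ⁻¹ ⟨2*(m+1) - k, hi⟩).isLt
        generalize ((σ⁻¹ ⟨2*(m+1) - k, hi⟩ : Fin m) : ℕ) = s at hL hX hs
        rw [hL, hX, Matrix.smul_vecMul, basisRow_vecMul,
          hshort _ (by omega) (by omega) (by omega), Matrix.smul_vecMul, basisRow_vecMul,
          show 2*(m+1) - (s + 1) = (m - 1 - s) + (m + 1) + 1 by omega,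
          natRow_wnOddMat_right F (by omega), Matrix.smul_vecMul, basisRow_vecMul,
          hshort _ (by omega) (by omega) (by omega)]

end embedding

theorem two_ne_zero_of_card [Fintype F] {p r : ℕ} (hp : p.Prime) (hp2 : p ≠ 2)
    (hcard : Fintype.card F = p ^ r) : (2 : F) ≠ 0 := by
  intro h
  have hodd : Odd (p ^ r) := (hp.odd_of_ne_two hp2).pow
  have h0 : ((Fintype.card F : ℕ) : F) = 0 := Nat.cast_card_eq_zero F
  obtain ⟨q, hq⟩ := hodd
  rw [hcard, hq] at h0
  simp [h] at h0

end rows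

theorem embedding_support_criterion
    (F : Type) [Field F] [Fintype F] (p r : ℕ) (hp : p.Prime) (hp2 : p ≠ 2)
    (hr : 0 < r) (hcard : Fintype.card F = p ^ r)
    (ψ : AddChar F ℂ) (hψ : ψ ≠ 1)
    (l : ℕ) (hl : 2 ≤ l) (ρ : F) (hρ : ∀ x : F, x ^ 2 ≠ ρ)
    (n : ℕ) (hn : n ≤ l - 1) (σp : Equiv.Perm (Fin n))
    (tv : ℕ → Fˣ) (a b : F) (hab : a ^ 2 - b ^ 2 * ρ = 1) :
    (embTop F l ρ (torusMat F l ρ tv a b * (tnMat F l n (permMat F n σp) * wTildeMat F l n)) ∈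
      {m : Matrix (Fin (2*l+1)) (Fin (2*l+1)) F |
        ∃ a' : GL (Fin l) F, ∃ u₁ ∈ VnSet F l, ∃ u₂ ∈ VnSet F l,
          m = lnMat F l ((a' : Matrix (Fin l) (Fin l) F)) * u₁ * wnOddMat F l * u₂}) ↔
      (n = l - 1 ∧ a ≠ 1) := by
  have h2 : (2 : F) ≠ 0 := two_ne_zero_of_card F hp hp2 hcard
  have hρ0 : ρ ≠ 0 := by
    rintro rfl
    exact hρ 0 (by simp)
  obtain ⟨m, rfl⟩ : ∃ m, l = m + 1 := ⟨l - 1, by omega⟩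
  rw [Nat.add_sub_cancel] at hn ⊢
  change (∃ a' : GL (Fin (m+1)) F, ∃ u₁ ∈ VnSet F (m+1), ∃ u₂ ∈ VnSet F (m+1),
    embTop F (m+1) ρ (torusWeyl F m ρ tv a b σp) = _) ↔ _
  constructor
  · rintro ⟨A, u₁, hu₁, u₂, hu₂, hX⟩
    by_contra hcon
    rcases hn.lt_or_eq with hlt | rfl
    · refine not_mem_siegel_cell F (k := m + 3) (by omega) (by omega) _ ?_ A hu₁ hu₂ hX
      intro j hj
      rw [natRow_embTop_mid F m ρ tv a b hn σp h2 hρ0 (by omega) (by omega)]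
      simp [basisRow, show ¬ (j : ℕ) = m + 3 by omega]
    · have ha : a = 1 := by
        by_contra ha
        exact hcon ⟨rfl, ha⟩
      refine not_mem_siegel_cell F (k := n + 2) (by omega) (by omega) _ ?_ A hu₁ hu₂ hX
      intro j hj
      rw [natRow_embTop_two F n ρ tv a b hn σp h2 hρ0, ha]
      simp [basisRow, show ¬ (j : ℕ) = n + 1 by omega, show ¬ (j : ℕ) = n + 2 by omega]
  · rintro ⟨rfl, ha⟩
    have hX := embTop_eq_siegel_cell F n ρ tv a b h2 hρ0 σp hab ha
    have hdet : IsUnit (monoMat F (n+1) (cellDiag F n ρ tv a) (shiftPerm σp⁻¹)) :=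
      IsUnit.of_mul_eq_one _
        (monoMat_mul_transpose F (n+1) _ (cellDiag_ne_zero F n ρ tv a h2 hρ0 ha) _)
    exact ⟨hdet.unit, _, siegelShort_mem_VnSet F (by omega) _ h2, _,
      siegelShort_mem_VnSet F (by omega) _ h2, hX⟩


end ConverseSO
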